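/- Let κ > 0 and assume in addition that W(x) := ∫ₓ¹ ds/a(s) belongs to L¹(0,1). There exist constants C > 0 and λ₀ > 0 such that for every λ ∈ ℝ with |λ| ≥ λ₀ the following holds. Suppose u, v, f : [0,1] → ℂ are absolutely continuous with u(0)=u(1)=v(0)=v(1)=f(0)=f(1)=0 and u', v', f' ∈ L²(0,1), with u' absolutely continuous; θ ∈ L²(0,1;ℂ) is locally absolutely continuous on (0,1] with θ(1)=0, √a·θ' ∈ L²(0,1), and aθ' extends to an absolutely continuous function on [0,1] with (aθ')' ∈ L²(0,1) and (aθ')(0) = 0; g, h ∈ L²(0,1;ℂ); and the resolvent system v − iλu = f, u'' − κθ' − iλv = g, (aθ')' − κv' − iλθ = h holds a.e. on (0,1). Then ∫₀¹ (|u'|² + |v|² + |θ|²) dx ≤ C ∫₀¹ (|f'|² + |g|² + |h|²) dx. -/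

import Mathlib

open MeasureTheory Set intervalIntegral Filter Topology

open scoped ComplexConjugate

/-- Lebesgue measure on the unit interval. -/
noncomputable abbrev unitMeasure : Measure ℝ := volume.restrict (Ioc (0:ℝ) 1)

/-- `F` is absolutely continuous on `[0,1]` with integrable derivative `f`. -/
structure IsPrimitive {E : Type*} [NormedAddCommGroup E] [NormedSpace ℝ E]
    (F f : ℝ → E) : Prop where
  integrable : IntervalIntegrable f volume 0 1
  eq : ∀ x ∈ Icc (0:ℝ) 1, F x = F 0 + ∫ s in (0:ℝ)..x, f s

namespace IsPrimitive

variable {E E' : Type*} [NormedAddCommGroup E] [NormedSpace ℝ E]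
  [NormedAddCommGroup E'] [NormedSpace ℝ E']

lemma integrable_unit {F f : ℝ → E} (h : IsPrimitive F f) : Integrable f unitMeasure :=
  (intervalIntegrable_iff_integrableOn_Ioc_of_le zero_le_one).1 h.integrable

lemma intervalIntegrable_zero {F f : ℝ → E} (h : IsPrimitive F f) {x : ℝ}
    (hx : x ∈ Icc (0:ℝ) 1) : IntervalIntegrable f volume 0 x :=
  h.integrable.mono_set (by
    rw [uIcc_of_le hx.1, uIcc_of_le zero_le_one]; exact Icc_subset_Icc_right hx.2)

lemma continuousOn {F f : ℝ → E} (h : IsPrimitive F f) : ContinuousOn F (Icc 0 1) := by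
  have h1 : ContinuousOn (fun x => F 0 + ∫ s in (0:ℝ)..x, f s) (Icc 0 1) := by
    have := intervalIntegral.continuousOn_primitive_interval' h.integrable
      (left_mem_uIcc (a := (0:ℝ)) (b := 1))
    rw [uIcc_of_le zero_le_one] at this
    exact continuousOn_const.add this
  exact h1.congr h.eq

lemma integral_eq {F f : ℝ → E} (h : IsPrimitive F f) :
    ∫ x, f x ∂unitMeasure = F 1 - F 0 := by
  rw [h.eq 1 (by simp), intervalIntegral.integral_of_le zero_le_one]
  simp

lemma add {F f G g : ℝ → E} (hF : IsPrimitive F f) (hG : IsPrimitive G g) :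
    IsPrimitive (fun x => F x + G x) (fun x => f x + g x) where
  integrable := hF.integrable.add hG.integrable
  eq x hx := by
    rw [intervalIntegral.integral_add (hF.intervalIntegrable_zero hx)
      (hG.intervalIntegrable_zero hx), hF.eq x hx, hG.eq x hx]
    abel

lemma sub {F f G g : ℝ → E} (hF : IsPrimitive F f) (hG : IsPrimitive G g) :
    IsPrimitive (fun x => F x - G x) (fun x => f x - g x) where
  integrable := hF.integrable.sub hG.integrable
  eq x hx := by
    rw [intervalIntegral.integral_sub (hF.intervalIntegrable_zero hx)
      (hG.intervalIntegrable_zero hx), hF.eq x hx, hG.eq x hx]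
    abel

lemma clm [CompleteSpace E] [CompleteSpace E'] {F f : ℝ → E} (hF : IsPrimitive F f) (L : E →L[ℝ] E') :
    IsPrimitive (fun x => L (F x)) (fun x => L (f x)) where
  integrable := ⟨L.integrable_comp hF.integrable.1, L.integrable_comp hF.integrable.2⟩
  eq x hx := by
    rw [L.intervalIntegral_comp_comm (hF.intervalIntegrable_zero hx), hF.eq x hx, map_add]

lemma star {F f : ℝ → ℂ} (hF : IsPrimitive F f) :
    IsPrimitive (fun x => conj (F x)) (fun x => conj (f x)) :=
  hF.clm (Complex.conjCLE : ℂ →L[ℝ] ℂ)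

lemma ofReal {F f : ℝ → ℝ} (hF : IsPrimitive F f) :
    IsPrimitive (fun x => (F x : ℂ)) (fun x => (f x : ℂ)) :=
  hF.clm Complex.ofRealCLM

lemma const_mul {F f : ℝ → ℂ} (hF : IsPrimitive F f) (c : ℂ) :
    IsPrimitive (fun x => c * F x) (fun x => c * f x) :=
  hF.clm ((ContinuousLinearMap.mul ℝ ℂ) c)

lemma mul_real {F f G g : ℝ → ℝ} (hF : IsPrimitive F f) (hG : IsPrimitive G g) :
    IsPrimitive (fun x => F x * G x) (fun x => f x * G x + F x * g x) where
  integrable := by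
    have hFc := hF.continuousOn
    have hGc := hG.continuousOn
    rw [← uIcc_of_le zero_le_one] at hFc hGc
    exact (hF.integrable.mul_continuousOn hGc).add (hG.integrable.continuousOn_mul hFc)
  eq x hx := by
    have hsub : uIcc 0 x ⊆ Icc 0 1 := by
      rw [uIcc_of_le hx.1]; exact Icc_subset_Icc_right hx.2
    have ac : ∀ {H k : ℝ → ℝ}, IsPrimitive H k →
        AbsolutelyContinuousOnInterval (fun y => H 0 + ∫ s in (0:ℝ)..y, k s) 0 x := fun hH =>
      (LipschitzWith.const _).lipschitzOnWith.absolutelyContinuousOnInterval.add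
        ((hH.intervalIntegrable_zero hx).absolutelyContinuousOnInterval_intervalIntegral
          left_mem_uIcc)
    have key := (ac hF).integral_deriv_mul_eq_sub (ac hG)
    have hder : ∀ {H k : ℝ → ℝ}, IsPrimitive H k → ∀ᵐ y, y ∈ uIcc 0 x →
        HasDerivAt (fun y => H 0 + ∫ s in (0:ℝ)..y, k s) (k y) y := fun hH => by
      filter_upwards [(hH.intervalIntegrable_zero hx).ae_hasDerivAt_integral] with y hy hyx
      exact (hy hyx 0 left_mem_uIcc).const_add _
    rw [intervalIntegral.integral_congr_ae (g := fun y => f y * G y + F y * g y)] at key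
    · rw [key, ← hF.eq x hx, ← hG.eq x hx]
      simp
    · filter_upwards [hder hF, hder hG] with y hyF hyG hy
      have hy' := uIoc_subset_uIcc hy
      rw [(hyF hy').deriv, (hyG hy').deriv, ← hF.eq y (hsub hy'), ← hG.eq y (hsub hy')]

lemma mul {F f G g : ℝ → ℂ} (hF : IsPrimitive F f) (hG : IsPrimitive G g) :
    IsPrimitive (fun x => F x * G x) (fun x => f x * G x + F x * g x) := by
  have hFr := hF.clm Complex.reCLM
  have hFi := hF.clm Complex.imCLM
  have hGr := hG.clm Complex.reCLM
  have hGi := hG.clm Complex.imCLM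
  have h := (((hFr.mul_real hGr).sub (hFi.mul_real hGi)).ofReal).add
    ((((hFr.mul_real hGi).add (hFi.mul_real hGr)).ofReal).const_mul Complex.I)
  convert h using 2 with x x
  · apply Complex.ext <;> simp
  · apply Complex.ext <;> simp <;> ring

lemma ae_eq_zero [CompleteSpace E] {F f : ℝ → E} (h : IsPrimitive F f)
    (hF : ∀ᵐ x ∂unitMeasure, F x = 0) :
    ∀ᵐ x ∂unitMeasure, f x = 0 := by
  have hcc : EqOn F (fun _ => 0) (Icc 0 1) := by
    refine Measure.eqOn_Icc_of_ae_eq volume zero_ne_one ?_ h.continuousOn continuousOn_const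
    rw [unitMeasure, restrict_Ioc_eq_restrict_Icc] at hF
    exact hF
  rw [unitMeasure, ← restrict_Ioo_eq_restrict_Ioc, ae_restrict_iff' measurableSet_Ioo]
  filter_upwards [h.integrable.ae_hasDerivAt_integral] with x hx hx1
  have hx2 : x ∈ uIcc (0:ℝ) 1 := by
    rw [uIcc_of_le zero_le_one]; exact Ioo_subset_Icc_self hx1
  have h1 := hx hx2 0 left_mem_uIcc
  have h2 : HasDerivAt (fun y => ∫ s in (0:ℝ)..y, f s) 0 x := by
    refine (hasDerivAt_const x (0:E)).congr_of_eventuallyEq ?_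
    filter_upwards [isOpen_Ioo.mem_nhds hx1] with y hy
    have hy' := Ioo_subset_Icc_self hy
    have := h.eq y hy'
    rw [hcc hy', hcc (by simp : (0:ℝ) ∈ Icc (0:ℝ) 1)] at this
    simpa using this.symm
  exact h1.unique h2

lemma memLp_two {F f : ℝ → E} (h : IsPrimitive F f) : MemLp F 2 unitMeasure := by
  have := isCompact_Icc.exists_bound_of_continuousOn h.continuousOn
  obtain ⟨C, hC⟩ := this
  refine MemLp.of_bound ?_ C ?_
  · exact (h.continuousOn.mono Ioc_subset_Icc_self).aestronglyMeasurable measurableSet_Ioc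
  · exact (ae_restrict_iff' measurableSet_Ioc).2
      (Eventually.of_forall fun x hx => hC x (Ioc_subset_Icc_self hx))

end IsPrimitive

/-- The `L²` norm on the unit interval. -/
noncomputable def unitNorm (f : ℝ → ℂ) : ℝ := √(∫ x, ‖f x‖ ^ 2 ∂unitMeasure)

lemma unitNorm_nonneg (f : ℝ → ℂ) : 0 ≤ unitNorm f := Real.sqrt_nonneg _

lemma unitNorm_sq (f : ℝ → ℂ) : unitNorm f ^ 2 = ∫ x, ‖f x‖ ^ 2 ∂unitMeasure :=
  Real.sq_sqrt (integral_nonneg fun _ => by positivity)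

/-- `r` is integrable on the unit interval with integral at most `R`. -/
def HasIntegralBound (r : ℝ → ℝ) (R : ℝ) : Prop :=
  Integrable r unitMeasure ∧ ∫ x, r x ∂unitMeasure ≤ R

namespace HasIntegralBound

lemma add {r s : ℝ → ℝ} {R S : ℝ} (hr : HasIntegralBound r R) (hs : HasIntegralBound s S) :
    HasIntegralBound (fun x => r x + s x) (R + S) :=
  ⟨hr.1.add hs.1, by rw [integral_add hr.1 hs.1]; exact add_le_add hr.2 hs.2⟩

lemma const_mul {r : ℝ → ℝ} {R c : ℝ} (hr : HasIntegralBound r R) (hc : 0 ≤ c) :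
    HasIntegralBound (fun x => c * r x) (c * R) :=
  ⟨hr.1.const_mul c, by rw [MeasureTheory.integral_const_mul]; exact mul_le_mul_of_nonneg_left hr.2 hc⟩

end HasIntegralBound

lemma integral_mul_norm_le {α : Type*} [MeasurableSpace α] {μ : Measure α} {f g : α → ℂ}
    (hf : MemLp f 2 μ) (hg : MemLp g 2 μ) :
    ∫ x, ‖f x‖ * ‖g x‖ ∂μ ≤ √(∫ x, ‖f x‖ ^ 2 ∂μ) * √(∫ x, ‖g x‖ ^ 2 ∂μ) := by
  have h := integral_mul_le_Lp_mul_Lq_of_nonneg (μ := μ) Real.HolderConjugate.two_two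
    (f := fun x => ‖f x‖) (g := fun x => ‖g x‖)
    (Eventually.of_forall fun _ => norm_nonneg _) (Eventually.of_forall fun _ => norm_nonneg _)
    (by simpa using hf.norm) (by simpa using hg.norm)
  simpa [Real.sqrt_eq_rpow] using h

lemma hasIntegralBound_mul {f g : ℝ → ℂ} (hf : MemLp f 2 unitMeasure)
    (hg : MemLp g 2 unitMeasure) :
    HasIntegralBound (fun x => ‖f x‖ * ‖g x‖) (unitNorm f * unitNorm g) :=
  ⟨hf.norm.integrable_mul hg.norm, integral_mul_norm_le hf hg⟩

lemma hasIntegralBound_sq {f : ℝ → ℂ} (hf : MemLp f 2 unitMeasure) :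
    HasIntegralBound (fun x => ‖f x‖ ^ 2) (unitNorm f ^ 2) :=
  ⟨hf.norm.integrable_sq, (unitNorm_sq f).ge⟩

lemma IsPrimitive.integral_le {E e : ℝ → ℂ} (hE : IsPrimitive E e) {q r : ℝ → ℝ} {R : ℝ}
    (hq : Integrable q unitMeasure) (hr : HasIntegralBound r R)
    (h : ∀ᵐ x ∂unitMeasure, q x ≤ (e x).re + r x) :
    ∫ x, q x ∂unitMeasure ≤ (E 1 - E 0).re + R := by
  have hre : Integrable (fun x => (e x).re) unitMeasure := hE.integrable_unit.re
  calc ∫ x, q x ∂unitMeasure ≤ ∫ x, ((e x).re + r x) ∂unitMeasure :=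
        integral_mono_ae hq (hre.add hr.1) h
    _ = (∫ x, e x ∂unitMeasure).re + ∫ x, r x ∂unitMeasure := by
        rw [integral_add hre hr.1]
        congr 1
        exact integral_re hE.integrable_unit
    _ ≤ _ := by rw [hE.integral_eq]; linarith [hr.2]

/-- An absolutely continuous function vanishing at `0` is bounded in `L²` by its derivative. -/
lemma IsPrimitive.unitNorm_le {F f : ℝ → ℂ} (h : IsPrimitive F f) (h0 : F 0 = 0)
    (hf : MemLp f 2 unitMeasure) : unitNorm F ≤ unitNorm f := by
  have hone : MemLp (fun _ => (1:ℂ)) 2 unitMeasure := memLp_const _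
  have hpt : ∀ x ∈ Ioc (0:ℝ) 1, ‖F x‖ ≤ unitNorm f := by
    intro x hx
    rw [h.eq x (Ioc_subset_Icc_self hx), h0, zero_add,
      intervalIntegral.integral_of_le hx.1.le]
    calc ‖∫ s in Ioc 0 x, f s‖ ≤ ∫ s in Ioc 0 x, ‖f s‖ := norm_integral_le_integral_norm _
      _ ≤ ∫ s, ‖f s‖ ∂unitMeasure :=
        setIntegral_mono_set h.integrable_unit.norm
          (Eventually.of_forall fun _ => norm_nonneg _)
          (Ioc_subset_Ioc_right hx.2).eventuallyLE
      _ ≤ unitNorm f := by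
        have := integral_mul_norm_le hf hone
        simpa [unitNorm] using this
  refine Real.sqrt_le_iff.2 ⟨unitNorm_nonneg f, ?_⟩
  calc ∫ x, ‖F x‖ ^ 2 ∂unitMeasure ≤ ∫ x, unitNorm f ^ 2 ∂unitMeasure := by
        refine integral_mono_ae h.memLp_two.norm.integrable_sq (integrable_const _) ?_
        exact (ae_restrict_iff' measurableSet_Ioc).2 (Eventually.of_forall fun x hx =>
          pow_le_pow_left₀ (norm_nonneg _) (hpt x hx) 2)
    _ = unitNorm f ^ 2 := by simp

lemma Complex.neg_norm_mul_le_re (z w : ℂ) : -(‖z‖ * ‖w‖) ≤ (z * conj w).re := by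
  have h := Complex.abs_re_le_norm (z * conj w)
  rw [norm_mul, Complex.norm_conj] at h
  exact (abs_le.1 h).1

lemma Complex.re_mul_conj_le (z w : ℂ) : (z * conj w).re ≤ ‖z‖ * ‖w‖ :=
  (Complex.re_le_norm _).trans (by rw [norm_mul, Complex.norm_conj])

/-- Solutions of the resolvent system, with `θ` absolutely continuous up to `0` and
`b = a θ'`. -/
structure IsResolventSolution (a : ℝ → ℝ) (κ lam : ℝ)
    (u u' u'' v v' f f' θ θ' b b' g h : ℝ → ℂ) : Prop where
  prim_u : IsPrimitive u u'
  prim_u' : IsPrimitive u' u''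
  prim_v : IsPrimitive v v'
  prim_f : IsPrimitive f f'
  prim_θ : IsPrimitive θ θ'
  prim_b : IsPrimitive b b'
  u_zero : u 0 = 0
  u_one : u 1 = 0
  v_zero : v 0 = 0
  v_one : v 1 = 0
  f_zero : f 0 = 0
  θ_one : θ 1 = 0
  b_zero : b 0 = 0
  memLp_f' : MemLp f' 2 unitMeasure
  memLp_g : MemLp g 2 unitMeasure
  memLp_h : MemLp h 2 unitMeasure
  memLp_sqrt : MemLp (fun x => (√(a x) : ℂ) * θ' x) 2 unitMeasure
  b_eq : ∀ᵐ x ∂unitMeasure, b x = (a x : ℂ) * θ' x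
  v_eq : ∀ᵐ x ∂unitMeasure, v x = Complex.I * lam * u x + f x
  v'_eq : ∀ᵐ x ∂unitMeasure, v' x = Complex.I * lam * u' x + f' x
  u''_eq : ∀ᵐ x ∂unitMeasure, u'' x = κ * θ' x + Complex.I * lam * v x + g x
  b'_eq : ∀ᵐ x ∂unitMeasure, b' x = κ * v' x + Complex.I * lam * θ x + h x

namespace IsResolventSolution

variable {a : ℝ → ℝ} {κ lam : ℝ} {u u' u'' v v' f f' θ θ' b b' g h : ℝ → ℂ}

lemma norm_sqrt_mul_sq {r : ℝ} (hr : 0 ≤ r) (z : ℂ) : ‖(√r : ℂ) * z‖ ^ 2 = r * ‖z‖ ^ 2 := by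
  rw [norm_mul, mul_pow, Complex.norm_real, Real.norm_eq_abs, sq_abs, Real.sq_sqrt hr]

/-- The dissipation estimate. -/
lemma dissipation_le (S : IsResolventSolution a κ lam u u' u'' v v' f f' θ θ' b b' g h)
    (hpos : ∀ᵐ x ∂unitMeasure, 0 ≤ a x) :
    unitNorm (fun x => (√(a x) : ℂ) * θ' x) ^ 2 ≤
      unitNorm f' * unitNorm u' + unitNorm g * unitNorm v + unitNorm h * unitNorm θ := by
  have hE := ((S.prim_u'.mul S.prim_v.star).add (S.prim_b.mul S.prim_θ.star)).sub
    ((S.prim_θ.mul S.prim_v.star).const_mul κ)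
  have hr := ((hasIntegralBound_mul S.memLp_f' S.prim_u'.memLp_two).add
    (hasIntegralBound_mul S.memLp_g S.prim_v.memLp_two)).add
    (hasIntegralBound_mul S.memLp_h S.prim_θ.memLp_two)
  have key := hE.integral_le (hasIntegralBound_sq S.memLp_sqrt).1 hr ?_
  · rw [unitNorm_sq]
    simpa [S.v_zero, S.v_one, S.θ_one, S.b_zero] using key
  · filter_upwards [hpos, S.b_eq, S.v'_eq, S.u''_eq, S.b'_eq] with x ha hb hv hu hb'
    rw [norm_sqrt_mul_sq ha]
    have h1 := Complex.neg_norm_mul_le_re (f' x) (u' x)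
    have h2 := Complex.neg_norm_mul_le_re (g x) (v x)
    have h3 := Complex.neg_norm_mul_le_re (h x) (θ x)
    have hid : (u'' x * conj (v x) + u' x * conj (v' x) +
        (b' x * conj (θ x) + b x * conj (θ' x)) -
        κ * (θ' x * conj (v x) + θ x * conj (v' x))).re =
        a x * ‖θ' x‖ ^ 2 + (f' x * conj (u' x)).re + (g x * conj (v x)).re +
        (h x * conj (θ x)).re := by
      rw [hb', hu, hv, hb, Complex.sq_norm, Complex.normSq_apply]
      simp
      ring
    rw [hid]
    linarith

lemma u'_one_le (S : IsResolventSolution a κ lam u u' u'' v v' f f' θ θ' b b' g h)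
    {a' : ℝ → ℝ} (ha : IsPrimitive a a') (hκ : 0 ≤ κ) {M M' : ℝ}
    (hM : ∀ᵐ x ∂unitMeasure, |a x| ≤ M) (hM' : ∀ᵐ x ∂unitMeasure, |a' x| ≤ M')
    (hM0 : 0 ≤ M) (hM0' : 0 ≤ M') (ha0 : a 0 = 0) :
    a 1 * ‖u' 1‖ ^ 2 ≤ M' * (unitNorm u' ^ 2 + unitNorm v ^ 2) +
      2 * κ * (unitNorm b * unitNorm u') + 2 * M * (unitNorm g * unitNorm u') +
      2 * M * (unitNorm v * unitNorm f') := by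
  have hE := (ha.ofReal.mul ((S.prim_u'.mul S.prim_u'.star).add
    (S.prim_v.mul S.prim_v.star))).const_mul (-1)
  have hu' := S.prim_u'.memLp_two
  have hv := S.prim_v.memLp_two
  have hr := ((((hasIntegralBound_sq hu').add (hasIntegralBound_sq hv)).const_mul hM0').add
    ((hasIntegralBound_mul S.prim_b.memLp_two hu').const_mul (by positivity : 0 ≤ 2 * κ))).add
    ((hasIntegralBound_mul S.memLp_g hu').const_mul (by positivity : 0 ≤ 2 * M)) |>.add
    ((hasIntegralBound_mul hv S.memLp_f').const_mul (by positivity : 0 ≤ 2 * M))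
  have key := hE.integral_le (q := fun _ => 0) (integrable_zero _ _ _) hr ?_
  · have h1 : ((-1 : ℂ) * ((a 1 : ℂ) * (u' 1 * conj (u' 1) + v 1 * conj (v 1))) -
        (-1) * ((a 0 : ℂ) * (u' 0 * conj (u' 0) + v 0 * conj (v 0)))).re =
        - (a 1 * ‖u' 1‖ ^ 2) := by
      rw [S.v_one, ha0, Complex.sq_norm, Complex.normSq_apply]
      simp
    rw [h1, MeasureTheory.integral_zero] at key
    linarith
  · filter_upwards [hM, hM', S.b_eq, S.v'_eq, S.u''_eq] with x ha ha' hb hv hu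
    have h1 := Complex.re_mul_conj_le (b x) (u' x)
    have hid : ((-1 : ℂ) * ((a' x : ℂ) * (u' x * conj (u' x) + v x * conj (v x)) +
        (a x : ℂ) * (u'' x * conj (u' x) + u' x * conj (u'' x) +
          (v' x * conj (v x) + v x * conj (v' x))))).re =
        - (a' x * (‖u' x‖ ^ 2 + ‖v x‖ ^ 2) + 2 * κ * (b x * conj (u' x)).re +
          2 * (a x * (g x * conj (u' x)).re) + 2 * (a x * (v x * conj (f' x)).re)) := by
      rw [hu, hv, hb]
      simp only [Complex.sq_norm, Complex.normSq_apply]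
      simp
      ring
    have hprod : ∀ z w : ℂ, a x * (z * conj w).re ≤ M * (‖z‖ * ‖w‖) := fun z w => by
      have h4 := Complex.abs_re_le_norm (z * conj w)
      rw [norm_mul, Complex.norm_conj] at h4
      calc a x * (z * conj w).re ≤ |a x| * |(z * conj w).re| := by
            rw [← abs_mul]; exact le_abs_self _
        _ ≤ _ := mul_le_mul ha h4 (abs_nonneg _) hM0
    have h5 := hprod (g x) (u' x)
    have h6 := hprod (v x) (f' x)
    have h7 : a' x * (‖u' x‖ ^ 2 + ‖v x‖ ^ 2) ≤ M' * (‖u' x‖ ^ 2 + ‖v x‖ ^ 2) :=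
      mul_le_mul_of_nonneg_right ((le_abs_self _).trans ha') (by positivity)
    have h8 := mul_le_mul_of_nonneg_left h1 (by positivity : 0 ≤ 2 * κ)
    rw [hid]
    linarith

lemma b_one_le (S : IsResolventSolution a κ lam u u' u'' v v' f f' θ θ' b b' g h)
    (hκ : 0 ≤ κ) :
    ‖b 1‖ ^ 2 ≤ 2 * κ * |lam| * (unitNorm u' * unitNorm b) +
      2 * κ * (unitNorm f' * unitNorm b) + 2 * |lam| * (unitNorm θ * unitNorm b) +
      2 * (unitNorm h * unitNorm b) := by
  have hE := (S.prim_b.mul S.prim_b.star).const_mul (-1)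
  have hb := S.prim_b.memLp_two
  have hr := (((hasIntegralBound_mul S.prim_u'.memLp_two hb).const_mul
      (by positivity : 0 ≤ 2 * κ * |lam|)).add
    ((hasIntegralBound_mul S.memLp_f' hb).const_mul (by positivity : 0 ≤ 2 * κ))).add
    ((hasIntegralBound_mul S.prim_θ.memLp_two hb).const_mul (by positivity : 0 ≤ 2 * |lam|))
    |>.add ((hasIntegralBound_mul S.memLp_h hb).const_mul (by positivity : (0:ℝ) ≤ 2))
  have key := hE.integral_le (q := fun _ => 0) (integrable_zero _ _ _) hr ?_
  · have h1 : ((-1 : ℂ) * (b 1 * conj (b 1)) - (-1) * (b 0 * conj (b 0))).re =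
        - ‖b 1‖ ^ 2 := by
      rw [S.b_zero, Complex.sq_norm, Complex.normSq_apply]
      simp
    rw [h1, MeasureTheory.integral_zero] at key
    linarith
  · filter_upwards [S.v'_eq, S.b'_eq] with x hv hb'
    have hid : ((-1 : ℂ) * (b' x * conj (b x) + b x * conj (b' x))).re =
        - (2 * (b' x * conj (b x)).re) := by
      simp
      ring
    have hn : ‖b' x‖ ≤ κ * (|lam| * ‖u' x‖ + ‖f' x‖) + |lam| * ‖θ x‖ + ‖h x‖ := by
      rw [hb', hv]
      refine (norm_add₃_le).trans ?_
      have h1 : ‖Complex.I * lam * u' x + f' x‖ ≤ |lam| * ‖u' x‖ + ‖f' x‖ :=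
        (norm_add_le _ _).trans (by simp)
      have h2 := mul_le_mul_of_nonneg_left h1 hκ
      simp only [norm_mul, Complex.norm_real, Complex.norm_I, Real.norm_eq_abs,
        abs_of_nonneg hκ, one_mul] at h2 ⊢
      linarith
    have h3 := mul_le_mul_of_nonneg_right hn (norm_nonneg (b x))
    have h4 := Complex.re_mul_conj_le (b' x) (b x)
    rw [hid]
    linarith

lemma unitNorm_v_le (S : IsResolventSolution a κ lam u u' u'' v v' f f' θ θ' b b' g h)
    (hκ : 0 ≤ κ) :
    unitNorm v ^ 2 ≤ unitNorm u' ^ 2 + unitNorm g * unitNorm u' +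
      unitNorm v * unitNorm f' + κ * (unitNorm θ * unitNorm u') := by
  have hE := ((S.prim_u'.mul S.prim_u.star).sub
    ((S.prim_θ.mul S.prim_u.star).const_mul κ)).const_mul (-1)
  have hu' := S.prim_u'.memLp_two
  have hv := S.prim_v.memLp_two
  have hr := (((hasIntegralBound_sq hu').add
    (hasIntegralBound_mul S.memLp_g S.prim_u.memLp_two)).add
    (hasIntegralBound_mul hv S.prim_f.memLp_two)).add
    ((hasIntegralBound_mul S.prim_θ.memLp_two hu').const_mul hκ)
  have key := hE.integral_le (hasIntegralBound_sq hv).1 hr ?_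
  · rw [unitNorm_sq v]
    have h1 := mul_le_mul_of_nonneg_left (S.prim_u.unitNorm_le S.u_zero hu') (unitNorm_nonneg g)
    have h2 := mul_le_mul_of_nonneg_left (S.prim_f.unitNorm_le S.f_zero S.memLp_f')
      (unitNorm_nonneg v)
    simp [S.u_zero, S.u_one] at key
    linarith
  · filter_upwards [S.v_eq, S.u''_eq] with x hv hu
    have h1 := Complex.re_mul_conj_le (g x) (u x)
    have h2 := Complex.re_mul_conj_le (v x) (f x)
    have h3 := Complex.neg_norm_mul_le_re (θ x) (u' x)
    have h4 := mul_le_mul_of_nonneg_left h3 hκ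
    have hid : ((-1 : ℂ) * (u'' x * conj (u x) + u' x * conj (u' x) -
        κ * (θ' x * conj (u x) + θ x * conj (u' x)))).re =
        ‖v x‖ ^ 2 - ‖u' x‖ ^ 2 - (g x * conj (u x)).re - (v x * conj (f x)).re +
          κ * (θ x * conj (u' x)).re := by
      have hf : f x = v x - Complex.I * lam * u x := by rw [hv]; ring
      rw [hu, hf]
      simp only [Complex.sq_norm, Complex.normSq_apply]
      simp
      ring
    rw [hid]
    linarith

lemma unitNorm_u'_le (S : IsResolventSolution a κ lam u u' u'' v v' f f' θ θ' b b' g h)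
    (hpos : ∀ᵐ x ∂unitMeasure, 0 ≤ a x) (hκ : 0 ≤ κ) :
    κ * |lam| * unitNorm u' ^ 2 ≤ ‖b 1‖ * ‖u' 1‖ + κ * (unitNorm f' * unitNorm u') +
      |lam| * (unitNorm θ * unitNorm u') + unitNorm h * unitNorm u' +
      κ * unitNorm (fun x => (√(a x) : ℂ) * θ' x) ^ 2 + |lam| * (unitNorm b * unitNorm v) +
      unitNorm b * unitNorm g := by
  obtain ⟨c, hc⟩ : ∃ c : ℂ, c = -Complex.I * (SignType.sign lam : ℝ) := ⟨_, rfl⟩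
  have hcn : ‖c‖ ≤ 1 := by
    rw [hc]
    rcases lt_trichotomy lam 0 with h0 | h0 | h0 <;> simp [h0]
  have hE := (S.prim_b.mul S.prim_u'.star).const_mul c
  have hu' := S.prim_u'.memLp_two
  have hb := S.prim_b.memLp_two
  have hr := ((((((hasIntegralBound_mul S.memLp_f' hu').const_mul hκ).add
    ((hasIntegralBound_mul S.prim_θ.memLp_two hu').const_mul (abs_nonneg lam))).add
    (hasIntegralBound_mul S.memLp_h hu')).add
    ((hasIntegralBound_sq S.memLp_sqrt).const_mul hκ)).add
    ((hasIntegralBound_mul hb S.prim_v.memLp_two).const_mul (abs_nonneg lam))).add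
    (hasIntegralBound_mul hb S.memLp_g)
  have key := hE.integral_le ((hasIntegralBound_sq hu').1.const_mul (κ * |lam|)) hr ?_
  · rw [MeasureTheory.integral_const_mul, ← unitNorm_sq, S.b_zero] at key
    have h1 : (c * (b 1 * conj (u' 1)) - c * (0 * conj (u' 0))).re ≤ ‖b 1‖ * ‖u' 1‖ := by
      refine (Complex.re_le_norm _).trans ?_
      rw [zero_mul, mul_zero, sub_zero, norm_mul c, norm_mul (b 1), Complex.norm_conj]
      exact mul_le_of_le_one_left (by positivity) hcn
    linarith
  · filter_upwards [hpos, S.b_eq, S.v'_eq, S.u''_eq, S.b'_eq] with x ha hb hv hu hb'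
    rw [norm_sqrt_mul_sq ha]
    set ρ : ℂ := κ * (f' x * conj (u' x)) + Complex.I * lam * (θ x * conj (u' x)) +
      h x * conj (u' x) + κ * (a x * (θ' x * conj (θ' x))) +
      -Complex.I * lam * (b x * conj (v x)) + b x * conj (g x) with hρ
    have hid : b' x * conj (u' x) + b x * conj (u'' x) =
        Complex.I * (κ * lam * (u' x * conj (u' x))) + ρ := by
      rw [hρ, hu, hb', hv, hb]
      simp only [map_add, map_mul, Complex.conj_I, Complex.conj_ofReal]
      ring
    have hcρ : -‖ρ‖ ≤ (c * ρ).re := by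
      have h1 := (abs_le.1 (Complex.abs_re_le_norm (c * ρ))).1
      have h2 : ‖c * ρ‖ ≤ ‖ρ‖ := by
        rw [norm_mul]; exact mul_le_of_le_one_left (norm_nonneg _) hcn
      linarith
    have hmain : (c * (Complex.I * (κ * lam * (u' x * conj (u' x))))).re =
        κ * |lam| * ‖u' x‖ ^ 2 := by
      have hs := sign_mul_self lam
      rw [hc, Complex.mul_conj, ← Complex.sq_norm, ← hs]
      have : -Complex.I * ((SignType.sign lam : ℝ) : ℂ) *
          (Complex.I * (κ * lam * ((‖u' x‖ ^ 2 : ℝ) : ℂ))) =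
          ((κ * ((SignType.sign lam : ℝ) * lam) * ‖u' x‖ ^ 2 : ℝ) : ℂ) := by
        push_cast
        linear_combination (-(((SignType.sign lam : ℝ) : ℂ) *
          (κ * lam * (‖u' x‖ : ℂ) ^ 2))) * Complex.I_sq
      rw [this, Complex.ofReal_re]
    have hρn : ‖ρ‖ ≤ κ * (‖f' x‖ * ‖u' x‖) + |lam| * (‖θ x‖ * ‖u' x‖) + ‖h x‖ * ‖u' x‖ +
        κ * (a x * ‖θ' x‖ ^ 2) + |lam| * (‖b x‖ * ‖v x‖) + ‖b x‖ * ‖g x‖ := by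
      rw [hρ]
      iterate 5 refine (norm_add_le _ _).trans (add_le_add ?_ ?_)
      all_goals simp [abs_of_nonneg hκ, abs_of_nonneg ha, sq]
    rw [hid, mul_add, Complex.add_re, hmain]
    linarith

lemma unitNorm_b_le (S : IsResolventSolution a κ lam u u' u'' v v' f f' θ θ' b b' g h)
    (hpos : ∀ᵐ x ∂unitMeasure, 0 ≤ a x) {M : ℝ} (hM : ∀ᵐ x ∂unitMeasure, |a x| ≤ M) :
    unitNorm b ^ 2 ≤ M * unitNorm (fun x => (√(a x) : ℂ) * θ' x) ^ 2 := by
  rw [unitNorm_sq, unitNorm_sq, ← MeasureTheory.integral_const_mul]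
  refine integral_mono_ae (hasIntegralBound_sq S.prim_b.memLp_two).1
    ((hasIntegralBound_sq S.memLp_sqrt).1.const_mul M) ?_
  filter_upwards [hpos, hM, S.b_eq] with x ha hM hb
  rw [norm_sqrt_mul_sq ha, hb, norm_mul, Complex.norm_real, Real.norm_eq_abs, mul_pow, sq,
    abs_of_nonneg ha, mul_assoc]
  exact mul_le_mul_of_nonneg_right ((le_abs_self _).trans hM) (by positivity)

lemma unitNorm_θ_le (S : IsResolventSolution a κ lam u u' u'' v v' f f' θ θ' b b' g h)
    (hpos : ∀ x ∈ Ioc (0:ℝ) 1, 0 < a x) (hcont : ContinuousOn a (Icc 0 1))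
    (hW : IntegrableOn (fun x => ∫ s in x..(1:ℝ), (a s)⁻¹) (Ioc (0:ℝ) 1) volume) :
    unitNorm θ ^ 2 ≤ (∫ x, (∫ s in x..(1:ℝ), (a s)⁻¹) ∂unitMeasure) *
      unitNorm (fun x => (√(a x) : ℂ) * θ' x) ^ 2 := by
  rw [unitNorm_sq, ← MeasureTheory.integral_mul_const]
  refine integral_mono_ae (hasIntegralBound_sq S.prim_θ.memLp_two).1 (hW.mul_const _) ?_
  refine (ae_restrict_iff' measurableSet_Ioc).2 (Eventually.of_forall fun x hx => ?_)
  have hsub : Icc x 1 ⊆ Ioc 0 1 := fun y hy => ⟨hx.1.trans_le hy.1, hy.2⟩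
  have hsub' : Ioc x 1 ⊆ Ioc 0 1 := Ioc_subset_Icc_self.trans hsub
  have hinv : ContinuousOn (fun s => (√(a s))⁻¹) (Icc x 1) :=
    ((hcont.mono (hsub.trans Ioc_subset_Icc_self)).sqrt).inv₀
      fun y hy => (Real.sqrt_pos.2 (hpos y (hsub hy))).ne'
  have hmem : MemLp (fun s => (((√(a s))⁻¹ : ℝ) : ℂ)) 2 (volume.restrict (Ioc x 1)) := by
    obtain ⟨C, hC⟩ := isCompact_Icc.exists_bound_of_continuousOn hinv
    refine MemLp.of_bound ?_ C ?_
    · exact (Complex.continuous_ofReal.comp_continuousOn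
        (hinv.mono Ioc_subset_Icc_self)).aestronglyMeasurable measurableSet_Ioc
    · refine (ae_restrict_iff' measurableSet_Ioc).2 (Eventually.of_forall fun y hy => ?_)
      rw [Complex.norm_real]
      exact hC y (Ioc_subset_Icc_self hy)
  have hθ : θ x = -∫ s in x..1, θ' s := by
    have h1 := S.prim_θ.eq x (Ioc_subset_Icc_self hx)
    have h2 := S.prim_θ.eq 1 (by simp)
    have h3 := intervalIntegral.integral_interval_sub_left
      (S.prim_θ.intervalIntegrable_zero (by simp : (1:ℝ) ∈ Icc (0:ℝ) 1))
      (S.prim_θ.intervalIntegrable_zero (Ioc_subset_Icc_self hx))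
    rw [← h3]
    rw [S.θ_one] at h2
    linear_combination h1 - h2
  have hmem2 : MemLp (fun s => (√(a s) : ℂ) * θ' s) 2 (volume.restrict (Ioc x 1)) :=
    S.memLp_sqrt.mono_measure (Measure.restrict_mono hsub' le_rfl)
  have hcs := integral_mul_norm_le hmem hmem2
  have hle : ‖θ x‖ ≤ ∫ s in Ioc x 1, ‖(((√(a s))⁻¹ : ℝ) : ℂ)‖ * ‖(√(a s) : ℂ) * θ' s‖ := by
    rw [hθ, norm_neg, intervalIntegral.integral_of_le hx.2]
    refine (MeasureTheory.norm_integral_le_integral_norm _).trans (le_of_eq ?_)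
    refine setIntegral_congr_fun measurableSet_Ioc fun s hs => ?_
    have hs0 := (Real.sqrt_pos.2 (hpos s (hsub' hs)))
    simp only [norm_mul, Complex.norm_real, norm_inv]
    rw [← mul_assoc, inv_mul_cancel₀ (norm_ne_zero_iff.2 hs0.ne'), one_mul]
  have hWx : ∫ s in Ioc x 1, ‖(((√(a s))⁻¹ : ℝ) : ℂ)‖ ^ 2 = ∫ s in x..1, (a s)⁻¹ := by
    rw [intervalIntegral.integral_of_le hx.2]
    refine setIntegral_congr_fun measurableSet_Ioc fun s hs => ?_
    simp only [Complex.norm_real, Real.norm_eq_abs, sq_abs, inv_pow]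
    rw [Real.sq_sqrt (hpos s (hsub' hs)).le]
  have hD : ∫ s in Ioc x 1, ‖(√(a s) : ℂ) * θ' s‖ ^ 2 ≤
      unitNorm (fun x => (√(a x) : ℂ) * θ' x) ^ 2 := by
    rw [unitNorm_sq]
    exact setIntegral_mono_set (hasIntegralBound_sq S.memLp_sqrt).1
      (Eventually.of_forall fun _ => by positivity) hsub'.eventuallyLE
  have hW0 : 0 ≤ ∫ s in x..1, (a s)⁻¹ := by
    rw [← hWx]; exact integral_nonneg fun _ => by positivity
  calc ‖θ x‖ ^ 2 ≤ (√(∫ s in x..1, (a s)⁻¹) *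
        √(∫ s in Ioc x 1, ‖(√(a s) : ℂ) * θ' s‖ ^ 2)) ^ 2 := by
        rw [← hWx]; exact pow_le_pow_left₀ (norm_nonneg _) (hle.trans hcs) 2
    _ = (∫ s in x..1, (a s)⁻¹) * ∫ s in Ioc x 1, ‖(√(a s) : ℂ) * θ' s‖ ^ 2 := by
        rw [mul_pow, Real.sq_sqrt hW0, Real.sq_sqrt (integral_nonneg fun _ => by positivity)]
    _ ≤ _ := mul_le_mul_of_nonneg_left hD hW0

end IsResolventSolution

/-- Absorption argument: the multiplier estimates bound the energy by the data, uniformly in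
the frequency `l ≥ 1`. -/
lemma exists_energy_bound {κ w M M' a₁ : ℝ} (hκ : 0 < κ) (hw : 0 ≤ w) (hM : 0 ≤ M)
    (hM' : 0 ≤ M') (ha₁ : 0 < a₁) :
    ∃ C > 0, ∀ l P V T D B Φ G H β m : ℝ, 1 ≤ l → 0 ≤ P → 0 ≤ V → 0 ≤ T → 0 ≤ B →
      0 ≤ Φ → 0 ≤ G → 0 ≤ H → 0 ≤ β → 0 ≤ m →
      D ^ 2 ≤ Φ * P + G * V + H * T →
      T ^ 2 ≤ w * D ^ 2 →
      B ^ 2 ≤ M * D ^ 2 →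
      κ * l * P ^ 2 ≤ β * m + κ * (Φ * P) + l * (T * P) + H * P + κ * D ^ 2 + l * (B * V) +
        B * G →
      β ^ 2 ≤ 2 * κ * l * (P * B) + 2 * κ * (Φ * B) + 2 * l * (T * B) + 2 * (H * B) →
      a₁ * m ^ 2 ≤ M' * (P ^ 2 + V ^ 2) + 2 * κ * (B * P) + 2 * M * (G * P) +
        2 * M * (V * Φ) →
      V ^ 2 ≤ P ^ 2 + G * P + V * Φ + κ * (T * P) →
      P ^ 2 + V ^ 2 + T ^ 2 ≤ C * (Φ ^ 2 + G ^ 2 + H ^ 2) := by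
  obtain ⟨K₁, hK₁⟩ : ∃ k, k = 3 * w + 1 := ⟨_, rfl⟩
  obtain ⟨K₂, hK₂⟩ : ∃ k, k = 3 * M + 1 := ⟨_, rfl⟩
  obtain ⟨K₃, hK₃⟩ : ∃ k, k = 2 * κ * K₂ + 2 * κ * K₂ + 2 * K₂ + 2 * K₂ := ⟨_, rfl⟩
  obtain ⟨K₄, hK₄⟩ : ∃ k, k = M' + 2 * κ * K₂ + 2 * M + 2 * M := ⟨_, rfl⟩
  obtain ⟨K₅, hK₅⟩ : ∃ k, k = K₃ * K₄ / a₁ + 1 := ⟨_, rfl⟩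
  obtain ⟨K₆, hK₆⟩ : ∃ k, k = (K₅ + κ + K₁ + 1 + 3 * κ + K₂ + K₂) / κ := ⟨_, rfl⟩
  obtain ⟨K₇, hK₇⟩ : ∃ k, k = K₆ + (K₆ + 1 + 1 + κ * K₁) + K₁ := ⟨_, rfl⟩
  have h₁ : 0 < K₁ := by rw [hK₁]; positivity
  have h₂ : 0 < K₂ := by rw [hK₂]; positivity
  have h₃ : 0 < K₃ := by rw [hK₃]; positivity
  have h₄ : 0 < K₄ := by rw [hK₄]; positivity
  have h₅ : 0 < K₅ := by rw [hK₅]; positivity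
  have h₆ : 0 < K₆ := by rw [hK₆]; positivity
  have h₇ : 0 < K₇ := by rw [hK₇]; positivity
  have sq_add_one : ∀ {x : ℝ}, 0 ≤ x → x ≤ (x + 1) ^ 2 := fun hx => by nlinarith
  refine ⟨K₇ ^ 8 + 1, by positivity, ?_⟩
  intro l P V T D B Φ G H β m hl hP hV hT hB hΦ hG hH hβ hm eD eT eB eP eβ em eV
  obtain ⟨U, hU⟩ : ∃ r, r = √(P ^ 2 + V ^ 2 + T ^ 2) := ⟨_, rfl⟩
  obtain ⟨F, hF⟩ : ∃ r, r = √(Φ ^ 2 + G ^ 2 + H ^ 2) := ⟨_, rfl⟩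
  have hUsq : U ^ 2 = P ^ 2 + V ^ 2 + T ^ 2 := hU ▸ Real.sq_sqrt (by positivity)
  have hFsq : F ^ 2 = Φ ^ 2 + G ^ 2 + H ^ 2 := hF ▸ Real.sq_sqrt (by positivity)
  have hU0 : 0 ≤ U := hU ▸ Real.sqrt_nonneg _
  have hF0 : 0 ≤ F := hF ▸ Real.sqrt_nonneg _
  rw [← hUsq, ← hFsq]
  rcases le_or_gt U F with hUF | hUF
  · have : U ^ 2 ≤ F ^ 2 := pow_le_pow_left₀ hU0 hUF 2
    have : 0 ≤ K₇ ^ 8 * F ^ 2 := by positivity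
    linarith
  have hUpos : 0 < U := hF0.trans_lt hUF
  obtain ⟨s, hs0, hs1, hsF⟩ : ∃ s : ℝ, 0 ≤ s ∧ s ≤ 1 ∧ F = s ^ 4 * U := by
    have hq : 0 ≤ F / U := by positivity
    refine ⟨√√(F / U), Real.sqrt_nonneg _, ?_, ?_⟩
    · exact Real.sqrt_le_one.2 (Real.sqrt_le_one.2 ((div_le_one hUpos).2 hUF.le))
    · have : √√(F / U) ^ 4 = F / U := by
        rw [show 4 = 2 * 2 from rfl, pow_mul, Real.sq_sqrt (Real.sqrt_nonneg _),
          Real.sq_sqrt hq]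
      rw [this, div_mul_cancel₀ _ hUpos.ne']
  have hs2 : s ^ 2 ≤ s := pow_le_of_le_one hs0 hs1 two_ne_zero
  have hs20 : 0 ≤ s ^ 2 := by positivity
  have hs4 : s ^ 4 ≤ s ^ 2 := pow_le_pow_of_le_one hs0 hs1 (by norm_num)
  have lePU : P ≤ U := abs_le_of_sq_le_sq' (by linarith [sq_nonneg V, sq_nonneg T]) hU0 |>.2
  have leVU : V ≤ U := abs_le_of_sq_le_sq' (by linarith [sq_nonneg P, sq_nonneg T]) hU0 |>.2
  have leTU : T ≤ U := abs_le_of_sq_le_sq' (by linarith [sq_nonneg V, sq_nonneg P]) hU0 |>.2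
  have leΦ : Φ ≤ s ^ 4 * U :=
    hsF ▸ (abs_le_of_sq_le_sq' (by linarith [sq_nonneg G, sq_nonneg H]) hF0).2
  have leG : G ≤ s ^ 4 * U :=
    hsF ▸ (abs_le_of_sq_le_sq' (by linarith [sq_nonneg Φ, sq_nonneg H]) hF0).2
  have leH : H ≤ s ^ 4 * U :=
    hsF ▸ (abs_le_of_sq_le_sq' (by linarith [sq_nonneg G, sq_nonneg Φ]) hF0).2
  have data_mul : ∀ {x y : ℝ}, 0 ≤ y → x ≤ s ^ 4 * U → y ≤ U → x * y ≤ s ^ 4 * U ^ 2 :=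
    fun hy hx hyU => (mul_le_mul hx hyU hy (by positivity)).trans_eq (by ring)
  have hUU : 0 ≤ U ^ 2 := by positivity
  have h4s : s ^ 4 * U ^ 2 ≤ s * U ^ 2 := mul_le_mul_of_nonneg_right (hs4.trans hs2) hUU
  have h2s : s ^ 2 * U ^ 2 ≤ s * U ^ 2 := mul_le_mul_of_nonneg_right hs2 hUU
  have hsU : s * U ^ 2 ≤ U ^ 2 := mul_le_of_le_one_left hUU hs1
  have leD : D ^ 2 ≤ 3 * (s ^ 4 * U ^ 2) := by
    linarith [data_mul hP leΦ lePU, data_mul hV leG leVU, data_mul hT leH leTU]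
  have root : ∀ {x c : ℝ}, 0 ≤ c → x ^ 2 ≤ c * D ^ 2 → x ≤ (3 * c + 1) * (s ^ 2 * U) := by
    intro x c hc hx
    refine le_of_sq_le_sq ?_ (by positivity)
    have h1 : c * D ^ 2 ≤ (3 * c) * (s ^ 4 * U ^ 2) := by
      linarith [mul_le_mul_of_nonneg_left leD hc]
    have h2 : (3 * c) * (s ^ 4 * U ^ 2) ≤ (3 * c + 1) ^ 2 * (s ^ 4 * U ^ 2) :=
      mul_le_mul_of_nonneg_right (sq_add_one (by positivity)) (by positivity)
    calc x ^ 2 ≤ _ := hx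
      _ ≤ _ := h1
      _ ≤ _ := h2
      _ = _ := by ring
  have leT : T ≤ K₁ * (s ^ 2 * U) := hK₁ ▸ root hw eT
  have leB : B ≤ K₂ * (s ^ 2 * U) := hK₂ ▸ root hM eB
  have B_mul : ∀ {y : ℝ}, 0 ≤ y → y ≤ U → B * y ≤ K₂ * (s ^ 2 * U ^ 2) :=
    fun hy hyU => (mul_le_mul leB hyU hy (by positivity)).trans_eq (by ring)
  have T_mul : ∀ {y : ℝ}, 0 ≤ y → y ≤ U → T * y ≤ K₁ * (s ^ 2 * U ^ 2) :=
    fun hy hyU => (mul_le_mul leT hyU hy (by positivity)).trans_eq (by ring)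
  have small : s ^ 4 * U ≤ U := mul_le_of_le_one_left hU0 (pow_le_one₀ hs0 hs1)
  have BP := B_mul hP lePU
  have BV := B_mul hV leVU
  have BT := B_mul hT leTU
  have BΦ := B_mul hΦ (leΦ.trans small)
  have BG := B_mul hG (leG.trans small)
  have BH := B_mul hH (leH.trans small)
  have TP := T_mul hP lePU
  have TT := T_mul hT leTU
  have leβ : β ^ 2 ≤ l * (K₃ * (s ^ 2 * U ^ 2)) := by
    have hX0 : 0 ≤ s ^ 2 * U ^ 2 := by positivity
    generalize s ^ 2 * U ^ 2 = X at *
    have hKl : K₂ * X ≤ l * (K₂ * X) := le_mul_of_one_le_left (by positivity) hl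
    have e1 : 2 * κ * l * (P * B) ≤ 2 * κ * l * (K₂ * X) :=
      mul_le_mul_of_nonneg_left (by linarith) (by positivity)
    have e2 : 2 * κ * (Φ * B) ≤ 2 * κ * (l * (K₂ * X)) :=
      mul_le_mul_of_nonneg_left (by linarith) (by positivity)
    have e3 : 2 * l * (T * B) ≤ 2 * l * (K₂ * X) :=
      mul_le_mul_of_nonneg_left (by linarith) (by positivity)
    have e4 : 2 * (H * B) ≤ 2 * (l * (K₂ * X)) := by linarith
    rw [hK₃]
    linarith
  have lem : a₁ * m ^ 2 ≤ K₄ * U ^ 2 := by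
    have e1 : M' * (P ^ 2 + V ^ 2) ≤ M' * U ^ 2 :=
      mul_le_mul_of_nonneg_left (by linarith [sq_nonneg T]) hM'
    have e2 : 2 * κ * (B * P) ≤ 2 * κ * (K₂ * U ^ 2) := by
      refine mul_le_mul_of_nonneg_left (BP.trans ?_) (by positivity)
      exact mul_le_mul_of_nonneg_left (h2s.trans hsU) h₂.le
    have e3 : 2 * M * (G * P) ≤ 2 * M * U ^ 2 :=
      mul_le_mul_of_nonneg_left ((data_mul hP leG lePU).trans (h4s.trans hsU)) (by positivity)
    have e4 : 2 * M * (V * Φ) ≤ 2 * M * U ^ 2 := by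
      rw [mul_comm V Φ]
      exact mul_le_mul_of_nonneg_left ((data_mul hV leΦ leVU).trans (h4s.trans hsU))
        (by positivity)
    rw [hK₄]
    linarith
  have leβm : β * m ≤ l * (K₅ * (s * U ^ 2)) := by
    refine le_of_sq_le_sq ?_ (by positivity)
    have e1 : m ^ 2 ≤ K₄ * U ^ 2 / a₁ := by
      rw [le_div_iff₀ ha₁]; linarith
    have e2 : β ^ 2 * m ^ 2 ≤ l * (K₃ * (s ^ 2 * U ^ 2)) * (K₄ * U ^ 2 / a₁) :=
      mul_le_mul leβ e1 (by positivity) (by positivity)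
    have e3 : K₃ * K₄ / a₁ ≤ K₅ ^ 2 := hK₅ ▸ sq_add_one (by positivity)
    have e4 : l ≤ l ^ 2 := le_self_pow₀ hl two_ne_zero
    calc (β * m) ^ 2 = β ^ 2 * m ^ 2 := by ring
      _ ≤ _ := e2
      _ = (l * (K₃ * K₄ / a₁)) * (s * U ^ 2) ^ 2 := by ring
      _ ≤ (l ^ 2 * K₅ ^ 2) * (s * U ^ 2) ^ 2 :=
          mul_le_mul_of_nonneg_right (mul_le_mul e4 e3 (by positivity) (by positivity))
            (by positivity)
      _ = _ := by ring
  have hX0 : 0 ≤ s * U ^ 2 := by positivity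
  obtain ⟨X, hX⟩ : ∃ x, x = s * U ^ 2 := ⟨_, rfl⟩
  rw [← hX] at h4s h2s hsU leβm hX0
  have lX : X ≤ l * X := le_mul_of_one_le_left hX0 hl
  have K₁X := mul_le_mul_of_nonneg_left h2s h₁.le
  have K₂X := mul_le_mul_of_nonneg_left h2s h₂.le
  have leP : P ^ 2 ≤ K₆ * X := by
    have e1 : κ * (Φ * P) ≤ κ * (l * X) :=
      mul_le_mul_of_nonneg_left (((data_mul hP leΦ lePU).trans h4s).trans lX) hκ.le
    have e2 : l * (T * P) ≤ l * (K₁ * X) :=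
      mul_le_mul_of_nonneg_left (TP.trans K₁X) (by positivity)
    have e3 : H * P ≤ l * X := ((data_mul hP leH lePU).trans h4s).trans lX
    have e4 : κ * D ^ 2 ≤ κ * (3 * (l * X)) :=
      mul_le_mul_of_nonneg_left (by linarith) hκ.le
    have e5 : l * (B * V) ≤ l * (K₂ * X) :=
      mul_le_mul_of_nonneg_left (BV.trans K₂X) (by positivity)
    have e6 : B * G ≤ l * (K₂ * X) :=
      (BG.trans K₂X).trans (le_mul_of_one_le_left (by positivity) hl)
    have e7 : (κ * l) * P ^ 2 ≤ (κ * l) * (K₆ * X) := by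
      have : (κ * l) * (K₆ * X) = l * ((K₅ + κ + K₁ + 1 + 3 * κ + K₂ + K₂) * X) := by
        rw [hK₆]; field_simp
      rw [this]
      linarith
    exact le_of_mul_le_mul_left e7 (by positivity)
  have leV : V ^ 2 ≤ (K₆ + 1 + 1 + κ * K₁) * X := by
    have e1 : G * P ≤ X := (data_mul hP leG lePU).trans h4s
    have e2 : Φ * V ≤ X := (data_mul hV leΦ leVU).trans h4s
    have e3 : κ * (T * P) ≤ κ * (K₁ * X) :=
      mul_le_mul_of_nonneg_left (TP.trans K₁X) hκ.le
    linarith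
  have leT2 : T ^ 2 ≤ K₁ * X := by linarith
  have hone : 1 * U ^ 2 ≤ (K₇ * s) * U ^ 2 := by
    have : (K₇ * s) * U ^ 2 = K₇ * X := by rw [hX]; ring
    rw [this, hK₇, one_mul, hUsq]
    linarith
  have hone' : 1 ≤ K₇ * s := le_of_mul_le_mul_right hone (by positivity)
  have h8 : 1 ≤ (K₇ * s) ^ 8 := one_le_pow₀ hone'
  have : (K₇ ^ 8) * F ^ 2 = (K₇ * s) ^ 8 * U ^ 2 := by rw [hsF]; ring
  have h9 : 1 * U ^ 2 ≤ (K₇ * s) ^ 8 * U ^ 2 := mul_le_mul_of_nonneg_right h8 hUU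
  have h10 : 0 ≤ F ^ 2 := by positivity
  linarith

lemma isPrimitive_derivWithin {a : ℝ → ℝ} (ha : ContDiffOn ℝ 1 a (Icc (0:ℝ) 1)) :
    IsPrimitive a (derivWithin a (Icc 0 1)) := by
  have hc : ContinuousOn (derivWithin a (Icc 0 1)) (Icc 0 1) :=
    ha.continuousOn_derivWithin (uniqueDiffOn_Icc zero_lt_one) le_rfl
  have hderiv : IntervalIntegrable (derivWithin a (Icc 0 1)) volume 0 1 :=
    ContinuousOn.intervalIntegrable (by rwa [uIcc_of_le zero_le_one])
  refine ⟨hderiv, fun x hx => ?_⟩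
  have hsub : Icc 0 x ⊆ Icc 0 1 := Icc_subset_Icc_right hx.2
  rw [intervalIntegral.integral_eq_sub_of_hasDerivAt_of_le hx.1 (f := a)
    (ha.continuousOn.mono hsub) (fun y hy => ?_)
    (hderiv.mono_set (by rwa [uIcc_of_le hx.1, uIcc_of_le zero_le_one]))]
  · ring
  · have hy' : y ∈ Ioo (0:ℝ) 1 := ⟨hy.1, hy.2.trans_le hx.2⟩
    exact (ha.differentiableOn one_ne_zero y
      (Ioo_subset_Icc_self hy')).hasDerivWithinAt.hasDerivAt (Icc_mem_nhds hy'.left hy'.right)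

/-- (Strongly degenerate case, assuming `W(x) = ∫ₓ¹ ds/a(s) ∈ L¹(0,1)`.)
Uniform resolvent estimate at high frequencies: there are `C > 0` and `λ₀ > 0` such that
for `|λ| ≥ λ₀` every solution of the resolvent system `v − iλu = f`,
`u'' − κθ' − iλv = g`, `(aθ')' − κv' − iλθ = h` satisfies
`∫₀¹(|u'|² + |v|² + |θ|²) ≤ C ∫₀¹(|f'|² + |g|² + |h|²)`. -/
theorem stmt_19 (a : ℝ → ℝ)
    (haC1 : ContDiffOn ℝ 1 a (Icc (0:ℝ) 1))
    (ha0 : a 0 = 0)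
    (hapos : ∀ x ∈ Ioc (0:ℝ) 1, 0 < a x)
    (hanotL1 : ¬ IntegrableOn (fun x => (a x)⁻¹) (Ioc (0:ℝ) 1) volume)
    (hasqrtL1 : IntegrableOn (fun x => (Real.sqrt (a x))⁻¹) (Ioc (0:ℝ) 1) volume)
    (hWL1 : IntegrableOn (fun x => ∫ s in x..(1:ℝ), (a s)⁻¹) (Ioc (0:ℝ) 1) volume)
    (κ : ℝ) (hκ : 0 < κ) :
    ∃ C > (0:ℝ), ∃ lam₀ > (0:ℝ), ∀ (lam : ℝ), lam₀ ≤ |lam| →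
      ∀ (u u' u'' v v' f f' θ θ' b b' g h : ℝ → ℂ),
      -- u, v, f absolutely continuous, vanishing at 0 and 1, with u', v', f' ∈ L²
      IntervalIntegrable u' volume 0 1 →
      (∀ x ∈ Icc (0:ℝ) 1, u x = u 0 + ∫ s in (0:ℝ)..x, u' s) →
      u 0 = 0 → u 1 = 0 →
      MemLp u' 2 (volume.restrict (Ioc (0:ℝ) 1)) →
      IntervalIntegrable v' volume 0 1 →
      (∀ x ∈ Icc (0:ℝ) 1, v x = v 0 + ∫ s in (0:ℝ)..x, v' s) →
      v 0 = 0 → v 1 = 0 →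
      MemLp v' 2 (volume.restrict (Ioc (0:ℝ) 1)) →
      IntervalIntegrable f' volume 0 1 →
      (∀ x ∈ Icc (0:ℝ) 1, f x = f 0 + ∫ s in (0:ℝ)..x, f' s) →
      f 0 = 0 → f 1 = 0 →
      MemLp f' 2 (volume.restrict (Ioc (0:ℝ) 1)) →
      -- u' absolutely continuous with a.e. derivative u''
      IntervalIntegrable u'' volume 0 1 →
      (∀ x ∈ Icc (0:ℝ) 1, u' x = u' 0 + ∫ s in (0:ℝ)..x, u'' s) →
      -- θ ∈ L², locally absolutely continuous on (0,1], θ(1)=0, √a·θ' ∈ L²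
      MemLp θ 2 (volume.restrict (Ioc (0:ℝ) 1)) →
      (∀ ε ∈ Ioc (0:ℝ) 1, IntervalIntegrable θ' volume ε 1) →
      (∀ x ∈ Ioc (0:ℝ) 1, θ x = θ 1 - ∫ s in x..(1:ℝ), θ' s) →
      θ 1 = 0 →
      MemLp (fun x => (Real.sqrt (a x) : ℂ) * θ' x) 2 (volume.restrict (Ioc (0:ℝ) 1)) →
      -- aθ' extends to an absolutely continuous function b on [0,1] with b' ∈ L², b 0 = 0
      (∀ x ∈ Ioc (0:ℝ) 1, b x = (a x : ℂ) * θ' x) →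
      IntervalIntegrable b' volume 0 1 →
      (∀ x ∈ Icc (0:ℝ) 1, b x = b 0 + ∫ s in (0:ℝ)..x, b' s) →
      MemLp b' 2 (volume.restrict (Ioc (0:ℝ) 1)) →
      b 0 = 0 →
      -- g, h ∈ L²
      MemLp g 2 (volume.restrict (Ioc (0:ℝ) 1)) →
      MemLp h 2 (volume.restrict (Ioc (0:ℝ) 1)) →
      -- resolvent system, a.e. on (0,1)
      (∀ᵐ x ∂volume, x ∈ Ioo (0:ℝ) 1 → v x - Complex.I * lam * u x = f x) →
      (∀ᵐ x ∂volume, x ∈ Ioo (0:ℝ) 1 →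
        u'' x - (κ : ℂ) * θ' x - Complex.I * lam * v x = g x) →
      (∀ᵐ x ∂volume, x ∈ Ioo (0:ℝ) 1 →
        b' x - (κ : ℂ) * v' x - Complex.I * lam * θ x = h x) →
      ∫ x in (0:ℝ)..1, (‖u' x‖ ^ 2 + ‖v x‖ ^ 2 + ‖θ x‖ ^ 2)
        ≤ C * ∫ x in (0:ℝ)..1, (‖f' x‖ ^ 2 + ‖g x‖ ^ 2 + ‖h x‖ ^ 2) := by
  obtain ⟨M, hM⟩ := isCompact_Icc.exists_bound_of_continuousOn haC1.continuousOn
  obtain ⟨M', hM'⟩ := isCompact_Icc.exists_bound_of_continuousOn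
    (haC1.continuousOn_derivWithin (uniqueDiffOn_Icc zero_lt_one) le_rfl)
  have h01 : (0:ℝ) ∈ Icc (0:ℝ) 1 := by simp
  have hM0 : 0 ≤ M := (norm_nonneg _).trans (hM 0 h01)
  have hM0' : 0 ≤ M' := (norm_nonneg _).trans (hM' 0 h01)
  have ae_of : ∀ {p : ℝ → Prop}, (∀ x ∈ Ioc (0:ℝ) 1, p x) → ∀ᵐ x ∂unitMeasure, p x :=
    fun hp => (ae_restrict_iff' measurableSet_Ioc).2 (Eventually.of_forall hp)
  have ae_of_Ioo : ∀ {p : ℝ → Prop}, (∀ᵐ x ∂volume, x ∈ Ioo (0:ℝ) 1 → p x) →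
      ∀ᵐ x ∂unitMeasure, p x := fun hp => by
    rw [unitMeasure, ← restrict_Ioo_eq_restrict_Ioc]
    exact (ae_restrict_iff' measurableSet_Ioo).2 hp
  have hw : 0 ≤ ∫ x, (∫ s in x..(1:ℝ), (a s)⁻¹) ∂unitMeasure := by
    refine setIntegral_nonneg measurableSet_Ioc fun x hx => ?_
    exact intervalIntegral.integral_nonneg hx.2
      fun s hs => (inv_pos.2 (hapos s ⟨hx.1.trans_le hs.1, hs.2⟩)).le
  obtain ⟨C, hC, hbound⟩ := exists_energy_bound hκ hw hM0 hM0' (hapos 1 (by simp))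
  refine ⟨C, hC, 1, one_pos, ?_⟩
  intro lam hlam u u' u'' v v' f f' θ θ' b b' g h hu'i hu hu0 hu1 hu'2 hv'i hv hv0 hv1 hv'2
    hf'i hf hf0 hf1 hf'2 hu''i hu' hθ2 hθ'i hθ hθ1 hsq hb hb'i hbp hb'2 hb0 hg hh eq1 eq2 eq3
  have eq1' := ae_of_Ioo eq1
  have eq2' := ae_of_Ioo eq2
  have eq3' := ae_of_Ioo eq3
  have pu : IsPrimitive u u' := ⟨hu'i, hu⟩
  have pu' : IsPrimitive u' u'' := ⟨hu''i, hu'⟩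
  have pv : IsPrimitive v v' := ⟨hv'i, hv⟩
  have pf : IsPrimitive f f' := ⟨hf'i, hf⟩
  -- The second equation makes `θ'` integrable up to the degenerate endpoint.
  have hκ0 : (κ : ℂ) ≠ 0 := Complex.ofReal_ne_zero.2 hκ.ne'
  have hθ' : Integrable θ' unitMeasure := by
    have h1 : Integrable (fun x => (κ : ℂ)⁻¹ * (u'' x - Complex.I * lam * v x - g x))
        unitMeasure :=
      ((pu'.integrable_unit.sub ((pv.memLp_two.integrable (by norm_num)).const_mul _)).sub
        (hg.integrable (by norm_num))).const_mul _
    refine h1.congr ?_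
    filter_upwards [eq2'] with x hx
    rw [← hx]
    field_simp
    ring
  have hθ'int : IntervalIntegrable θ' volume 0 1 :=
    (intervalIntegrable_iff_integrableOn_Ioc_of_le zero_le_one).2 hθ'
  set ϑ : ℝ → ℂ := fun x => (∫ s in (0:ℝ)..x, θ' s) - ∫ s in (0:ℝ)..1, θ' s with hϑ
  have pϑ : IsPrimitive ϑ θ' := ⟨hθ'int, fun x _ => by simp [hϑ]; ring⟩
  have hθϑ : ∀ x ∈ Ioc (0:ℝ) 1, θ x = ϑ x := fun x hx => by
    rw [hθ x hx, hθ1, hϑ, ← intervalIntegral.integral_interval_sub_left hθ'int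
      (pϑ.intervalIntegrable_zero (Ioc_subset_Icc_self hx))]
    ring
  have S : IsResolventSolution a κ lam u u' u'' v v' f f' ϑ θ' b b' g h :=
    { prim_u := pu
      prim_u' := pu'
      prim_v := pv
      prim_f := pf
      prim_θ := pϑ
      prim_b := ⟨hb'i, hbp⟩
      u_zero := hu0
      u_one := hu1
      v_zero := hv0
      v_one := hv1
      f_zero := hf0
      θ_one := by simp [hϑ]
      b_zero := hb0
      memLp_f' := hf'2
      memLp_g := hg
      memLp_h := hh
      memLp_sqrt := hsq
      b_eq := ae_of hb
      v_eq := by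
        filter_upwards [eq1'] with x hx
        rw [← hx]; ring
      v'_eq := by
        have h1 := ((pv.sub (pu.const_mul (Complex.I * lam))).sub pf).ae_eq_zero (by
          filter_upwards [eq1'] with x hx
          rw [hx, sub_self])
        filter_upwards [h1] with x hx
        linear_combination hx
      u''_eq := by
        filter_upwards [eq2'] with x hx
        rw [← hx]; ring
      b'_eq := by
        filter_upwards [eq3', ae_of hθϑ] with x hx hx'
        rw [← hx, ← hx']; ring }
  have hpos : ∀ᵐ x ∂unitMeasure, 0 ≤ a x := ae_of fun x hx => (hapos x hx).le
  have hMae : ∀ᵐ x ∂unitMeasure, |a x| ≤ M := ae_of fun x hx => hM x (Ioc_subset_Icc_self hx)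
  have hMae' : ∀ᵐ x ∂unitMeasure, |derivWithin a (Icc 0 1) x| ≤ M' :=
    ae_of fun x hx => hM' x (Ioc_subset_Icc_self hx)
  have key := hbound |lam| (unitNorm u') (unitNorm v) (unitNorm ϑ)
    (unitNorm fun x => (√(a x) : ℂ) * θ' x) (unitNorm b) (unitNorm f') (unitNorm g) (unitNorm h)
    ‖b 1‖ ‖u' 1‖ hlam (unitNorm_nonneg _) (unitNorm_nonneg _) (unitNorm_nonneg _)
    (unitNorm_nonneg _) (unitNorm_nonneg _) (unitNorm_nonneg _) (unitNorm_nonneg _)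
    (norm_nonneg _) (norm_nonneg _) (S.dissipation_le hpos)
    (S.unitNorm_θ_le hapos haC1.continuousOn hWL1) (S.unitNorm_b_le hpos hMae)
    (S.unitNorm_u'_le hpos hκ.le) (S.b_one_le hκ.le)
    (S.u'_one_le (isPrimitive_derivWithin haC1) hκ.le hMae hMae' hM0 hM0' ha0)
    (S.unitNorm_v_le hκ.le)
  have sum_eq : ∀ {p q r : ℝ → ℂ}, MemLp p 2 unitMeasure → MemLp q 2 unitMeasure →
      MemLp r 2 unitMeasure → ∫ x in (0:ℝ)..1, (‖p x‖ ^ 2 + ‖q x‖ ^ 2 + ‖r x‖ ^ 2) =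
      unitNorm p ^ 2 + unitNorm q ^ 2 + unitNorm r ^ 2 := fun {p q r} hp hq hr => by
    rw [intervalIntegral.integral_of_le zero_le_one, unitNorm_sq, unitNorm_sq, unitNorm_sq,
      ← MeasureTheory.integral_add hp.norm.integrable_sq hq.norm.integrable_sq,
      ← MeasureTheory.integral_add (hasIntegralBound_sq hp |>.add (hasIntegralBound_sq hq)).1
        hr.norm.integrable_sq]
  have hθn : unitNorm θ = unitNorm ϑ := by
    rw [unitNorm, unitNorm]
    congr 1
    exact setIntegral_congr_fun measurableSet_Ioc fun x hx => by simp only [hθϑ x hx]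
  rw [sum_eq hu'2 pv.memLp_two hθ2, sum_eq hf'2 hg hh, hθn]
  exact key
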